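/- There exists a universal constant σ₀ > 0 such that for every σ < σ₀, every q > 0, and every s with σ^{1/8} ≤ s/q ≤ π − σ^{1/16}, setting P = γ(s) and Q = γ(πq) = (2q,0,0), the closed ball {Q' ∈ ℍ : d(P,Q') ≤ d(P,Q)} intersects the plane {t = 0} in exactly the single point Q. -/

import Mathlib

noncomputable section

open MeasureTheory

/-- Points of the Heisenberg group `ℍ`, identified with `ℝ³ ≅ ℂ × ℝ`:
`(x, y, t)` corresponds to `(z ; t)` with `z = x + iy`. -/
abbrev H : Type := ℝ × ℝ × ℝ

/-- The Heisenberg group law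
`(x,y,t)·(x',y',t') = (x+x', y+y', t+t'+2(x'y − xy'))`. -/
def Hmul (p q : H) : H :=
  (p.1 + q.1, p.2.1 + q.2.1, p.2.2 + q.2.2 + 2 * (q.1 * p.2.1 - p.1 * q.2.1))

/-- The Heisenberg group inverse. -/
def Hinv (p : H) : H := (-p.1, -p.2.1, -p.2.2)

/-- The identity `O = (0,0,0)`. -/
def HO : H := (0, 0, 0)

/-- The control (Carnot–Carathéodory) distance: the infimum of the lengths
`∫₀¹ √(a(s)² + b(s)²) ds` of horizontal Lipschitz curves `γ` joining `P` to `Q`,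
i.e. curves satisfying a.e. `γ' = a·X(γ) + b·Y(γ)` where `X = ∂ₓ + 2y∂_t` and
`Y = ∂_y − 2x∂_t`. -/
def dH (P Q : H) : ℝ :=
  sInf { L : ℝ | ∃ (γ : ℝ → H) (a b : ℝ → ℝ) (K : NNReal),
    LipschitzWith K γ ∧ γ 0 = P ∧ γ 1 = Q ∧
    (∀ᵐ s ∂volume, s ∈ Set.Icc (0:ℝ) 1 →
      HasDerivAt γ (a s, b s, 2 * (γ s).2.1 * a s - 2 * (γ s).1 * b s) s) ∧
    IntervalIntegrable (fun s => Real.sqrt (a s ^ 2 + b s ^ 2)) volume 0 1 ∧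
    L = ∫ s in (0:ℝ)..1, Real.sqrt (a s ^ 2 + b s ^ 2) }

/-- `γ : ℝ → ℍ` is a `(1+ε)`-quasigeodesic. -/
def IsQuasiGeodesic (ε : ℝ) (γ : ℝ → H) : Prop :=
  ∀ s s' : ℝ, (1 + ε)⁻¹ * |s - s'| ≤ dH (γ s) (γ s') ∧
    dH (γ s) (γ s') ≤ (1 + ε) * |s - s'|

/-- `f : ℍ → ℍ` is `(1+ε)`-biLipschitz for the control distance. -/
def IsBiLip (ε : ℝ) (f : H → H) : Prop :=
  ∀ P Q : H, (1 + ε)⁻¹ * dH P Q ≤ dH (f P) (f Q) ∧ dH (f P) (f Q) ≤ (1 + ε) * dH P Q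

/-- `(a,b)` is the horizontal speed of `γ`: a.e. `γ'(s) = a(s)X(γ(s)) + b(s)Y(γ(s))`. -/
def HasHorizSpeed (γ : ℝ → H) (a b : ℝ → ℝ) : Prop :=
  ∀ᵐ s ∂volume, HasDerivAt γ (a s, b s, 2 * (γ s).2.1 * a s - 2 * (γ s).1 * b s) s

/-- The unit-speed geodesic of total lifetime `2πq` with
`γ(0) = (0,0,−2πq²)` and `γ(πq) = (2q,0,0)`. -/
def geoq (q s : ℝ) : H :=
  (q * (1 - Real.cos (s / q)), q * Real.sin (s / q),
    2 * q ^ 2 * (s / q - Real.pi - Real.sin (s / q)))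

/-- Lengths of horizontal curves from `P` to `Q`. -/
def Hset (P Q : H) : Set ℝ :=
  { L : ℝ | ∃ (γ : ℝ → H) (a b : ℝ → ℝ) (K : NNReal),
    LipschitzWith K γ ∧ γ 0 = P ∧ γ 1 = Q ∧
    (∀ᵐ s ∂volume, s ∈ Set.Icc (0:ℝ) 1 →
      HasDerivAt γ (a s, b s, 2 * (γ s).2.1 * a s - 2 * (γ s).1 * b s) s) ∧
    IntervalIntegrable (fun s => Real.sqrt (a s ^ 2 + b s ^ 2)) volume 0 1 ∧
    L = ∫ s in (0:ℝ)..1, Real.sqrt (a s ^ 2 + b s ^ 2) }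

lemma dH_eq (P Q : H) : dH P Q = sInf (Hset P Q) := rfl

lemma Hset_nonneg {P Q : H} {L : ℝ} (h : L ∈ Hset P Q) : 0 ≤ L := by
  obtain ⟨γ, a, b, K, -, -, -, -, -, rfl⟩ := h
  exact intervalIntegral.integral_nonneg (by norm_num) (fun _ _ => Real.sqrt_nonneg _)

lemma smooth_mem (f : ℝ → H) (a b : ℝ → ℝ) (hf : ContDiff ℝ 1 f)
    (ha : Continuous a) (hb : Continuous b)
    (hd : ∀ s, HasDerivAt f (a s, b s, 2 * (f s).2.1 * a s - 2 * (f s).1 * b s) s) :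
    (∫ s in (0:ℝ)..1, Real.sqrt (a s ^ 2 + b s ^ 2)) ∈ Hset (f 0) (f 1) := by
  obtain ⟨K, hK⟩ := (hf.contDiffOn (s := Set.Icc (0:ℝ) 1)).exists_lipschitzOnWith one_ne_zero
    (convex_Icc _ _) isCompact_Icc
  refine ⟨fun u => f (Set.projIcc 0 1 zero_le_one u), a, b, K * 1, ?_, ?_, ?_, ?_, ?_, rfl⟩
  · exact (lipschitzOnWith_iff_restrict.mp hK).comp (LipschitzWith.projIcc zero_le_one)
  · simp [Set.projIcc]
  · simp [Set.projIcc]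
  · have h₁ : ∀ᵐ x : ℝ, x ≠ 0 := by simp [ae_iff, measure_singleton]
    have h₂ : ∀ᵐ x : ℝ, x ≠ 1 := by simp [ae_iff, measure_singleton]
    filter_upwards [h₁, h₂] with u h0 h1 hu
    have hI : Set.Ioo (0:ℝ) 1 ∈ nhds u :=
      Ioo_mem_nhds (lt_of_le_of_ne hu.1 (Ne.symm h0)) (lt_of_le_of_ne hu.2 h1)
    have e : ∀ v ∈ Set.Icc (0:ℝ) 1, ((Set.projIcc (0:ℝ) 1 zero_le_one v : Set.Icc (0:ℝ) 1) : ℝ) = v := by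
      intro v hv
      rw [Set.projIcc_of_mem _ hv]
    simp only [e u hu]
    refine (hd u).congr_of_eventuallyEq ?_
    filter_upwards [hI] with v hv
    rw [e v ⟨hv.1.le, hv.2.le⟩]
  · exact Continuous.intervalIntegrable (by fun_prop) _ _

lemma Hset_nonempty (P Q : H) : (Hset P Q).Nonempty := by
  obtain ⟨x0, y0, t0⟩ := P
  obtain ⟨x1, y1, t1⟩ := Q
  obtain ⟨d, hd⟩ : ∃ d, d = x1 - x0 := ⟨_, rfl⟩
  obtain ⟨e, he⟩ : ∃ e, e = y1 - y0 := ⟨_, rfl⟩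
  obtain ⟨B, hB⟩ : ∃ B, B = 35 / 2 * (t1 - t0 - 2 * (y0 * d - x0 * e)) := ⟨_, rfl⟩
  have key := smooth_mem (fun u => (x0 + d * u + (u - 3*u^2+2*u^3),
      y0 + e * u + B * (u - 6*u^2 + 10*u^3-5*u^4),
      t0 + 2 * ((y0*d - x0*e)*u + y0*(u - 3*u^2+2*u^3) - x0*B*(u - 6*u^2 + 10*u^3-5*u^4)
        + e * (u*(u - 3*u^2+2*u^3) - 2*(u^2/2-u^3+u^4/2))
        + d*B*(2*(u^2/2-2*u^3+5*u^4/2-u^5) - u*(u - 6*u^2 + 10*u^3-5*u^4))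
        + B*(u^3-4*u^4+33/5*u^5-5*u^6+10/7*u^7))))
    (fun u => d + (1-6*u+6*u^2)) (fun u => e + B*(1-12*u+30*u^2-20*u^3))
    (by fun_prop) (by fun_prop) (by fun_prop) (by
      intro s
      have p : ∀ n : ℕ, HasDerivAt (fun u : ℝ => u ^ n) (n * s ^ (n-1)) s := fun n => hasDerivAt_pow n s
      have i := hasDerivAt_id' s
      have h1 : HasDerivAt (fun u : ℝ => u - 3*u^2+2*u^3) (1-6*s+6*s^2) s := by
        refine ((i.sub ((p 2).const_mul 3)).add ((p 3).const_mul 2)).congr_deriv ?_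
        norm_num; ring
      have h2 : HasDerivAt (fun u : ℝ => u - 6*u^2 + 10*u^3-5*u^4) (1-12*s+30*s^2-20*s^3) s := by
        refine (((i.sub ((p 2).const_mul 6)).add ((p 3).const_mul 10)).sub ((p 4).const_mul 5)).congr_deriv ?_
        norm_num; ring
      have h3 : HasDerivAt (fun u : ℝ => u^2/2-u^3+u^4/2) (s - 3*s^2+2*s^3) s := by
        refine ((((p 2).div_const 2).sub (p 3)).add ((p 4).div_const 2)).congr_deriv ?_
        norm_num; ring
      have h4 : HasDerivAt (fun u : ℝ => u^2/2-2*u^3+5*u^4/2-u^5) (s - 6*s^2+10*s^3-5*s^4) s := by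
        refine (((((p 2).div_const 2).sub ((p 3).const_mul 2)).add (((p 4).const_mul 5).div_const 2)).sub (p 5)).congr_deriv ?_
        norm_num; ring
      have h5 : HasDerivAt (fun u : ℝ => u^3-4*u^4+33/5*u^5-5*u^6+10/7*u^7)
          (3*s^2-16*s^3+33*s^4-30*s^5+10*s^6) s := by
        refine (((((p 3).sub ((p 4).const_mul 4)).add ((p 5).const_mul (33/5))).sub ((p 6).const_mul 5)).add ((p 7).const_mul (10/7))).congr_deriv ?_
        norm_num; ring
      refine HasDerivAt.prodMk ?_ (HasDerivAt.prodMk ?_ ?_)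
      · refine (((i.const_mul d).const_add x0).add h1).congr_deriv ?_
        ring
      · refine (((i.const_mul e).const_add y0).add (h2.const_mul B)).congr_deriv ?_
        ring
      · refine (((((((i.const_mul (y0*d-x0*e)).add (h1.const_mul y0)).sub (h2.const_mul (x0*B))).add
          (((i.mul h1).sub (h3.const_mul 2)).const_mul e)).add
          (((h4.const_mul 2).sub (i.mul h2)).const_mul (d*B))).add (h5.const_mul B)).const_mul 2).const_add t0
          |>.congr_deriv ?_
        ring)
  have k1 : (Hset _ _).Nonempty := ⟨_, key⟩
  refine Eq.mp (congrArg Set.Nonempty (congrArg₂ Hset ?_ ?_)) k1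
  · refine Prod.ext ?_ (Prod.ext ?_ ?_)
    all_goals (simp only; ring)
  · refine Prod.ext ?_ (Prod.ext ?_ ?_)
    · simp only [hd]; ring
    · simp only [he]; ring
    · simp only [hB]; ring

lemma ac_comp {f g : ℝ → ℝ} {s : Set ℝ} {C : NNReal} {a b : ℝ} (hg : LipschitzOnWith C g s)
    (hm : Set.MapsTo f (Set.uIcc a b) s) (hf : AbsolutelyContinuousOnInterval f a b) :
    AbsolutelyContinuousOnInterval (fun u => g (f u)) a b := by
  rw [absolutelyContinuousOnInterval_iff] at hf ⊢
  intro ε hε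
  obtain ⟨δ, hδ, h⟩ := hf (ε / (C + 1)) (by positivity)
  refine ⟨δ, hδ, fun E hE hl => ?_⟩
  have h1 := h E hE hl
  calc _ ≤ ∑ i ∈ Finset.range E.1, (C + 1) * dist (f (E.2 i).1) (f (E.2 i).2) := by
        refine Finset.sum_le_sum fun i hi => ?_
        refine (hg.dist_le_mul _ (hm (hE.1 i hi).1) _ (hm (hE.1 i hi).2)).trans ?_
        gcongr
        simp
    _ < ε := by
        rw [← Finset.mul_sum]
        rw [lt_div_iff₀ (by positivity)] at h1
        linarith

lemma pointwise {X Y a b c S κ v : ℝ} (hκ : 0 < κ) (hv : 0 ≤ v) (hv2 : v ^ 2 = a ^ 2 + b ^ 2)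
    (hS : S = c ^ 2 + 1) :
    2 * Y * a - 2 * X * b + (c * (2 * (X * a + Y * b)) - κ * v * S * (X ^ 2 + Y ^ 2)) ≤ v / κ := by
  rcases hv.eq_or_lt with h | h
  · subst h
    have ha : a = 0 := by nlinarith [sq_nonneg a, sq_nonneg b]
    have hb : b = 0 := by nlinarith [sq_nonneg a, sq_nonneg b]
    simp [ha, hb]
  · rw [le_div_iff₀ hκ]
    have : 0 ≤ v * (v - (2 * Y * a - 2 * X * b + (c * (2 * (X * a + Y * b)) - κ * v * S * (X ^ 2 + Y ^ 2))) * κ) := by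
      have e : v * (v - (2 * Y * a - 2 * X * b + (c * (2 * (X * a + Y * b)) - κ * v * S * (X ^ 2 + Y ^ 2))) * κ)
        = (a - κ * v * (c * X + Y)) ^ 2 + (b - κ * v * (c * Y - X)) ^ 2 := by
        rw [hS]; linear_combination hv2
      rw [e]; positivity
    have := nonneg_of_mul_nonneg_right this h
    linarith

lemma core0 {X Y T a b v c : ℝ → ℝ} {κ : ℝ} (hκ : 0 < κ) (hv0 : ∀ u, 0 ≤ v u)
    (hv : ∀ u, v u ^ 2 = a u ^ 2 + b u ^ 2) (hint : IntervalIntegrable v volume 0 1)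
    (hX : AbsolutelyContinuousOnInterval X 0 1) (hY : AbsolutelyContinuousOnInterval Y 0 1)
    (hT : AbsolutelyContinuousOnInterval T 0 1) (hc : AbsolutelyContinuousOnInterval c 0 1)
    (hX0 : X 0 = 0) (hY0 : Y 0 = 0) (hT0 : T 0 = 0)
    (hd : ∀ᵐ u, u ∈ Set.Icc (0:ℝ) 1 → HasDerivAt X (a u) u ∧ HasDerivAt Y (b u) u ∧
      HasDerivAt T (2 * Y u * a u - 2 * X u * b u) u ∧
      HasDerivAt c (- (κ * v u * (c u ^ 2 + 1))) u) :
    (T 1 + c 1 * (X 1 ^ 2 + Y 1 ^ 2)) * κ ≤ ∫ u in (0:ℝ)..1, v u := by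
  have hGac : AbsolutelyContinuousOnInterval (T + c * (X * X + Y * Y)) 0 1 :=
    hT.add (hc.mul ((hX.mul hX).add (hY.mul hY)))
  have hGd : ∀ᵐ u, u ∈ Set.Icc (0:ℝ) 1 → deriv (T + c * (X * X + Y * Y)) u ≤ v u / κ := by
    filter_upwards [hd] with u hu hI
    obtain ⟨dX, dY, dT, dc⟩ := hu hI
    rw [(dT.add (dc.mul ((dX.mul dX).add (dY.mul dY)))).deriv]
    refine le_trans (le_of_eq ?_) (pointwise (X := X u) (Y := Y u) (c := c u) hκ (hv0 u) (hv u) rfl)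
    simp only [Pi.mul_apply, Pi.add_apply]
    ring
  have hFTC := hGac.integral_deriv_eq_sub
  have hle : ∫ u in (0:ℝ)..1, deriv (T + c * (X * X + Y * Y)) u ≤ ∫ u in (0:ℝ)..1, v u / κ := by
    refine intervalIntegral.integral_mono_ae_restrict zero_le_one hGac.intervalIntegrable_deriv
      (hint.div_const κ) ?_
    exact (ae_restrict_iff' measurableSet_Icc).mpr hGd
  rw [hFTC, intervalIntegral.integral_div, le_div_iff₀ hκ] at hle
  simp only [Pi.mul_apply, Pi.add_apply, hX0, hY0, hT0] at hle
  refine le_trans (le_of_eq ?_) hle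
  ring

lemma cot_lip {p r : ℝ} (h : ∀ x ∈ Set.Icc p r, 0 < Real.sin x) :
    ∃ C : NNReal, LipschitzOnWith C (fun x => Real.cos x / Real.sin x) (Set.Icc p r) := by
  have h1 : ContDiffOn ℝ 1 (fun x => Real.cos x / Real.sin x) (Set.Icc p r) :=
    Real.contDiff_cos.contDiffOn.div Real.contDiff_sin.contDiffOn (fun x hx => (h x hx).ne')
  exact h1.exists_lipschitzOnWith one_ne_zero (convex_Icc _ _) isCompact_Icc

lemma phase {v : ℝ → ℝ} {L M α κ : ℝ} (hv0 : ∀ u, 0 ≤ v u)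
    (hint : IntervalIntegrable v volume 0 1) (hLe : L = ∫ u in (0:ℝ)..1, v u) (hM : L < M)
    (h1 : α < Real.pi) (hκ0 : 0 < κ) (hκM : κ * M = α) :
    ∃ c : ℝ → ℝ, AbsolutelyContinuousOnInterval c 0 1 ∧ c 1 = Real.cos α / Real.sin α ∧
      ∀ᵐ u, u ∈ Set.Icc (0:ℝ) 1 → HasDerivAt c (- (κ * v u * (c u ^ 2 + 1))) u := by
  have hu01 : Set.uIcc (0:ℝ) 1 = Set.Icc 0 1 := Set.uIcc_of_le zero_le_one
  obtain ⟨lam, hlam⟩ : ∃ lam : ℝ → ℝ, lam = fun u => ∫ s in (0:ℝ)..u, v s := ⟨_, rfl⟩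
  have hlam0 : ∀ u ∈ Set.Icc (0:ℝ) 1, 0 ≤ lam u := fun u hu => by
    rw [hlam]
    exact intervalIntegral.integral_nonneg hu.1 (fun _ _ => hv0 _)
  have hlam1 : ∀ u ∈ Set.Icc (0:ℝ) 1, lam u ≤ L := by
    intro u hu
    rw [hLe, hlam]
    exact intervalIntegral.integral_mono_interval le_rfl hu.1 hu.2
      (Filter.Eventually.of_forall hv0) hint
  have hlamac : AbsolutelyContinuousOnInterval lam 0 1 := by
    rw [hlam]
    exact hint.absolutelyContinuousOnInterval_intervalIntegral (by simp)
  have hlamd : ∀ᵐ u, u ∈ Set.Icc (0:ℝ) 1 → HasDerivAt lam (v u) u := by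
    filter_upwards [hint.ae_hasDerivAt_integral] with u hu h
    rw [hlam]
    exact hu (by rwa [hu01]) 0 (by simp)
  have hlamL : lam 1 = L := by rw [hLe, hlam]
  obtain ⟨ψ, hψ⟩ : ∃ ψ : ℝ → ℝ, ψ = fun u => κ * (M - L + lam u) := ⟨_, rfl⟩
  have hψm : ∀ u ∈ Set.Icc (0:ℝ) 1, ψ u ∈ Set.Icc (κ * (M - L)) α := by
    intro u hu
    rw [hψ]
    constructor
    · exact mul_le_mul_of_nonneg_left (by linarith [hlam0 u hu]) hκ0.le
    · rw [← hκM]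
      exact mul_le_mul_of_nonneg_left (by linarith [hlam1 u hu]) hκ0.le
  have hsinpos : ∀ x ∈ Set.Icc (κ * (M - L)) α, 0 < Real.sin x := by
    intro x hx
    have : 0 < κ * (M - L) := mul_pos hκ0 (by linarith)
    exact Real.sin_pos_of_pos_of_lt_pi (by linarith [hx.1]) (by linarith [hx.2])
  have hψac : AbsolutelyContinuousOnInterval ψ 0 1 := by
    have hc : AbsolutelyContinuousOnInterval (fun _ : ℝ => M - L) 0 1 :=
      ContDiffOn.absolutelyContinuousOnInterval contDiffOn_const
    rw [hψ]
    exact (hc.add hlamac).const_mul κ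
  obtain ⟨C, hC⟩ := cot_lip hsinpos
  have hac := ac_comp hC (hu01 ▸ hψm : Set.MapsTo ψ (Set.uIcc 0 1) _) hψac
  refine ⟨fun u => Real.cos (ψ u) / Real.sin (ψ u), hac, ?_, ?_⟩
  · have : ψ 1 = α := by rw [hψ, ← hκM]; simp only [hlamL]; ring
    simp only [this]
  · filter_upwards [hlamd] with u hl hI
    have dψ : HasDerivAt ψ (κ * v u) u := by
      rw [hψ]
      exact ((hl hI).const_add (M - L)).const_mul κ
    have hs := hsinpos _ (hψm u hI)
    refine (dψ.cos.div dψ.sin hs.ne').congr_deriv ?_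
    field_simp
    ring

lemma core {P Q : H} {L M α : ℝ} (hL : L ∈ Hset P Q) (hM : L < M) (h0 : 0 < α)
    (h1 : α < Real.pi) :
    α * (Q.2.2 - P.2.2 + 2 * (P.1 * Q.2.1 - Q.1 * P.2.1))
      + α * (Real.cos α / Real.sin α) * ((Q.1 - P.1) ^ 2 + (Q.2.1 - P.2.1) ^ 2) ≤ L * M := by
  have hL0 := Hset_nonneg hL
  obtain ⟨γ, a, b, K, hγ, hP, hQ, hder, hint, hLe⟩ := hL
  have hMp : 0 < M := by linarith
  obtain ⟨κ, hκ⟩ : ∃ κ, κ = α / M := ⟨_, rfl⟩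
  have hκ0 : 0 < κ := by rw [hκ]; positivity
  have hκM : κ * M = α := by rw [hκ]; field_simp
  obtain ⟨c, hcac, hc1, hcd⟩ := phase (fun u => Real.sqrt_nonneg _) hint hLe hM h1 hκ0 hκM
  have hxac : AbsolutelyContinuousOnInterval (fun u => (γ u).1) 0 1 :=
    ((LipschitzWith.prod_fst.comp hγ).lipschitzOnWith).absolutelyContinuousOnInterval
  have hyac : AbsolutelyContinuousOnInterval (fun u => (γ u).2.1) 0 1 :=
    ((LipschitzWith.prod_fst.comp (LipschitzWith.prod_snd.comp hγ)).lipschitzOnWith).absolutelyContinuousOnInterval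
  have htac : AbsolutelyContinuousOnInterval (fun u => (γ u).2.2) 0 1 :=
    ((LipschitzWith.prod_snd.comp (LipschitzWith.prod_snd.comp hγ)).lipschitzOnWith).absolutelyContinuousOnInterval
  have hcst : ∀ k : ℝ, AbsolutelyContinuousOnInterval (fun _ : ℝ => k) 0 1 := fun k =>
      ContDiffOn.absolutelyContinuousOnInterval contDiffOn_const
  have key := core0 (X := fun u => (γ u).1 - P.1) (Y := fun u => (γ u).2.1 - P.2.1)
    (T := fun u => (γ u).2.2 - P.2.2 + 2 * (P.1 * (γ u).2.1 - P.2.1 * (γ u).1))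
    (a := a) (b := b) hκ0 (fun u => Real.sqrt_nonneg _) (fun u => Real.sq_sqrt (by positivity)) hint
    (hxac.sub (hcst _)) (hyac.sub (hcst _))
    ((htac.sub (hcst _)).add (((hyac.const_mul P.1).sub (hxac.const_mul P.2.1)).const_mul 2))
    hcac (by simp only [hP]; ring) (by simp only [hP]; ring) (by simp only [hP]; ring) (by
      filter_upwards [hder, hcd] with u hu hl hI
      have hd := hu hI
      have dx : HasDerivAt (fun u => (γ u).1) (a u) u :=
        ((ContinuousLinearMap.fst ℝ ℝ (ℝ × ℝ)).hasFDerivAt (x := γ u)).comp_hasDerivAt u hd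
      have dy : HasDerivAt (fun u => (γ u).2.1) (b u) u :=
        (((ContinuousLinearMap.fst ℝ ℝ ℝ).comp (ContinuousLinearMap.snd ℝ ℝ (ℝ × ℝ))).hasFDerivAt (x := γ u)).comp_hasDerivAt u hd
      have dt : HasDerivAt (fun u => (γ u).2.2) (2 * (γ u).2.1 * a u - 2 * (γ u).1 * b u) u :=
        (((ContinuousLinearMap.snd ℝ ℝ ℝ).comp (ContinuousLinearMap.snd ℝ ℝ (ℝ × ℝ))).hasFDerivAt (x := γ u)).comp_hasDerivAt u hd
      refine ⟨dx.sub_const _, dy.sub_const _, ?_, hl hI⟩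
      refine ((dt.sub_const _).add (((dy.const_mul P.1).sub (dx.const_mul P.2.1)).const_mul 2)).congr_deriv ?_
      ring)
  rw [← hLe, hc1] at key
  simp only [hQ] at key
  have := mul_le_mul_of_nonneg_right key hMp.le
  rw [mul_assoc, hκM] at this
  linarith

lemma lower (P Q : H) {α : ℝ} (h0 : 0 < α) (h1 : α < Real.pi) :
    α * (Q.2.2 - P.2.2 + 2 * (P.1 * Q.2.1 - Q.1 * P.2.1))
      + α * (Real.cos α / Real.sin α) * ((Q.1 - P.1) ^ 2 + (Q.2.1 - P.2.1) ^ 2) ≤ dH P Q ^ 2 := by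
  have hd : 0 ≤ dH P Q := Real.sInf_nonneg (fun L hL => Hset_nonneg hL)
  have key : ∀ M, dH P Q < M → α * (Q.2.2 - P.2.2 + 2 * (P.1 * Q.2.1 - Q.1 * P.2.1))
      + α * (Real.cos α / Real.sin α) * ((Q.1 - P.1) ^ 2 + (Q.2.1 - P.2.1) ^ 2) ≤ M ^ 2 := by
    intro M hM
    obtain ⟨L, hL, hLM⟩ := exists_lt_of_csInf_lt (Hset_nonempty P Q) hM
    refine (core hL hLM h0 h1).trans ?_
    nlinarith [Hset_nonneg hL]
  have hT : Filter.Tendsto (fun M : ℝ => M ^ 2) (nhdsWithin (dH P Q) (Set.Ioi (dH P Q)))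
      (nhds (dH P Q ^ 2)) := ((continuous_pow 2).tendsto _).mono_left nhdsWithin_le_nhds
  exact ge_of_tendsto hT (by filter_upwards [self_mem_nhdsWithin] with M hM using key M hM)

lemma upper (q s : ℝ) (hq : 0 < q) (hs : s ≤ Real.pi * q) :
    dH (geoq q s) ((2 * q, 0, 0) : H) ≤ Real.pi * q - s := by
  obtain ⟨ℓ, hℓ⟩ : ∃ ℓ, ℓ = Real.pi * q - s := ⟨_, rfl⟩
  have hbd : BddBelow (Hset (geoq q s) ((2 * q, 0, 0) : H)) := ⟨0, fun L hL => Hset_nonneg hL⟩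
  have key := smooth_mem (fun u => geoq q (s + u * ℓ))
    (fun u => ℓ * Real.sin ((s + u * ℓ) / q)) (fun u => ℓ * Real.cos ((s + u * ℓ) / q))
    (by unfold geoq; fun_prop) (by fun_prop) (by fun_prop) (by
      intro u
      have hi : HasDerivAt (fun u : ℝ => (s + u * ℓ) / q) (ℓ / q) u := by
        refine ((((hasDerivAt_id' u).mul_const ℓ).const_add s).div_const q).congr_deriv ?_
        ring
      unfold geoq
      refine HasDerivAt.prodMk ?_ (HasDerivAt.prodMk ?_ ?_)
      · refine ((hi.cos.const_sub 1).const_mul q).congr_deriv ?_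
        field_simp
      · refine (hi.sin.const_mul q).congr_deriv ?_
        field_simp
      · refine (((hi.sub_const Real.pi).sub hi.sin).const_mul (2 * q ^ 2)).congr_deriv ?_
        have := Real.sin_sq_add_cos_sq ((s + u * ℓ) / q)
        simp only
        generalize Real.sin ((s + u * ℓ) / q) = S at *
        generalize Real.cos ((s + u * ℓ) / q) = C at *
        field_simp
        linear_combination (-ℓ) * this)
  have e1 : (∫ u in (0:ℝ)..1, Real.sqrt ((ℓ * Real.sin ((s + u * ℓ) / q)) ^ 2
      + (ℓ * Real.cos ((s + u * ℓ) / q)) ^ 2)) = ℓ := by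
    have : ∀ u : ℝ, Real.sqrt ((ℓ * Real.sin ((s + u * ℓ) / q)) ^ 2
      + (ℓ * Real.cos ((s + u * ℓ) / q)) ^ 2) = ℓ := by
      intro u
      rw [mul_pow, mul_pow, ← mul_add, Real.sin_sq_add_cos_sq, mul_one, Real.sqrt_sq]
      linarith
    simp [this]
  have e2 : geoq q (s + 0 * ℓ) = geoq q s := by simp
  have e3 : geoq q (s + 1 * ℓ) = ((2 * q, 0, 0) : H) := by
    have : (s + 1 * ℓ) / q = Real.pi := by rw [hℓ]; field_simp; ring
    unfold geoq
    rw [this]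
    ext <;> simp
    ring
  simp only [e1, e2, e3] at key
  rw [dH_eq, ← hℓ]
  exact csInf_le hbd key

lemma alg {α S C x y q p : ℝ} (hS : S ≠ 0) (h : S ^ 2 + C ^ 2 = 1) :
    α * (C / S) * ((x - 2 * q) ^ 2 + y ^ 2) =
    α * (0 - 2 * q ^ 2 * (p - 2 * α - p - 2 * S * C)
      + 2 * (q * (1 - -(2 * C ^ 2 - 1)) * y - x * (q * (2 * S * C))))
      + α * (C / S) * ((x - q * (1 - -(2 * C ^ 2 - 1))) ^ 2 + (y - q * (2 * S * C)) ^ 2)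
      - (2 * α * q) ^ 2 := by
  obtain ⟨k, hk⟩ : ∃ k, k = C / S := ⟨_, rfl⟩
  have hC : k * S = C := by rw [hk]; field_simp
  rw [← hk]
  have h' : S ^ 2 * (1 + k ^ 2) = 1 := by rw [← hC] at h; linear_combination h
  rw [← hC]
  linear_combination (4 * α * q * k * x - 4 * α * q ^ 2 * k * (1 + k ^ 2 * S ^ 2)) * h'

/-- Proposition, part 1: tangency of a ball to `{t = 0}`.
There is a universal `σ₀ > 0` such that for all `σ < σ₀`, `q > 0` and `s` with
`σ^{1/8} ≤ s/q ≤ π − σ^{1/16}`, setting `P = γ(s)` and `Q = γ(πq) = (2q,0,0)`,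
the closed ball `{Q' : d(P,Q') ≤ d(P,Q)}` meets the plane `{t = 0}` exactly in
the single point `Q`. -/
theorem statement15 :
    ∃ σ₀ > (0:ℝ), ∀ σ : ℝ, 0 < σ → σ < σ₀ →
      ∀ q : ℝ, 0 < q → ∀ s : ℝ,
        σ ^ ((1:ℝ)/8) ≤ s / q → s / q ≤ Real.pi - σ ^ ((1:ℝ)/16) →
        {Q' : H | dH (geoq q s) Q' ≤ dH (geoq q s) ((2 * q, 0, 0) : H)} ∩
            {p : H | p.2.2 = 0}
          = {((2 * q, 0, 0) : H)} := by
  refine ⟨1, one_pos, ?_⟩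
  intro σ hσ _ q hq s hs1 hs2
  have hp1 : 0 < s / q := lt_of_lt_of_le (Real.rpow_pos_of_pos hσ _) hs1
  have hp2 : s / q < Real.pi := lt_of_le_of_lt hs2 (by linarith [Real.rpow_pos_of_pos hσ ((1:ℝ)/16)])
  ext Q'
  simp only [Set.mem_inter_iff, Set.mem_ofPred_eq, Set.mem_singleton_iff]
  constructor
  swap
  · rintro rfl
    exact ⟨le_rfl, rfl⟩
  rintro ⟨hd, ht⟩
  obtain ⟨x, y, t⟩ := Q'
  simp only at ht
  subst ht
  obtain ⟨α, hα⟩ : ∃ α, α = (Real.pi - s / q) / 2 := ⟨_, rfl⟩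
  have hα0 : 0 < α := by rw [hα]; linarith
  have hα1 : α < Real.pi / 2 := by rw [hα]; linarith
  have hsq : s / q = Real.pi - 2 * α := by rw [hα]; ring
  have hsq' : s = (Real.pi - 2 * α) * q := by rw [← hsq]; field_simp
  have hup := upper q s hq (by rw [hsq']; nlinarith)
  have hlo := lower (geoq q s) (x, y, 0) hα0 (by linarith [Real.pi_pos])
  have hd0 : 0 ≤ dH (geoq q s) (x, y, 0) := Real.sInf_nonneg (fun L hL => Hset_nonneg hL)
  have hsin : 0 < Real.sin α := Real.sin_pos_of_pos_of_lt_pi hα0 (by linarith [Real.pi_pos])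
  have hcos : 0 < Real.cos α := Real.cos_pos_of_mem_Ioo ⟨by linarith, hα1⟩
  have hle : dH (geoq q s) (x, y, 0) ^ 2 ≤ (2 * α * q) ^ 2 := by
    refine pow_le_pow_left₀ hd0 ((hd.trans hup).trans (le_of_eq ?_)) 2
    rw [hsq']; ring
  have hfin := hlo.trans hle
  unfold geoq at hfin
  simp only [hsq, Real.cos_pi_sub, Real.sin_pi_sub, Real.cos_two_mul, Real.sin_two_mul] at hfin
  have hcs := Real.sin_sq_add_cos_sq α
  generalize Real.sin α = S at *
  generalize Real.cos α = C at *
  have hk : α * (C / S) * ((x - 2 * q) ^ 2 + y ^ 2) ≤ 0 := by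
    refine le_trans (le_of_eq ?_) (sub_nonpos.mpr hfin)
    exact alg hsin.ne' hcs
  have hpos : 0 < α * (C / S) := by positivity
  have hz : (x - 2 * q) ^ 2 + y ^ 2 ≤ 0 := by
    by_contra hcon
    push Not at hcon
    linarith [mul_pos hpos hcon]
  have hx1 : (x - 2 * q) ^ 2 = 0 :=
    le_antisymm (by linarith [sq_nonneg y]) (sq_nonneg _)
  have hy1 : y ^ 2 = 0 :=
    le_antisymm (by linarith [sq_nonneg (x - 2 * q)]) (sq_nonneg _)
  have hx : x = 2 * q := sub_eq_zero.mp (pow_eq_zero_iff two_ne_zero |>.mp hx1)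
  have hy : y = 0 := pow_eq_zero_iff two_ne_zero |>.mp hy1
  rw [hx, hy]
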